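/- arXiv:2002.10311 — 4 statements merged into one kernel-verified Lean document; each statement's English description precedes it below -/
import Mathlib

section
/- Let n ≥ 1, let ρ = Σ_{j=1}^{n} (n − j)e_j ∈ ℤⁿ, and for 0 ≤ i ≤ n set ∂′₀ = ρ and ∂′ᵢ = Σ_{j=1}^{i} (i + 1 − j)e_j + ρ for i ≥ 1. For λ ∈ ℤⁿ let N_odd(λ) be the number of odd entries of λ. Then the map i ↦ N_odd(∂′ᵢ) is a bijection from {0, 1, …, n} to {0, 1, …, n}; in particular the values N_odd(∂′₀), …, N_odd(∂′ₙ) are pairwise distinct. -/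
/-- The number of indices `i` with `l i` odd. -/
noncomputable def nOdd (n : ℕ) (l : Fin n → ℤ) : ℕ := Nat.card {i : Fin n // Odd (l i)}

/-- The shifted 2-core weight `∂′ᵢ = Σ_{j=1}^{i} (i + 1 − j) eⱼ + ρ`, where
`ρ = Σ_{j=1}^{n} (n − j) eⱼ` (indices written 0-based). -/
def dprime (n : ℕ) (i : Fin (n + 1)) : Fin n → ℤ :=
  fun j => (if (j : ℕ) < (i : ℕ) then (i : ℤ) - (j : ℕ) else 0) + ((n : ℤ) - 1 - (j : ℕ))

theorem nOdd_eq_sum_range (n : ℕ) (f : ℕ → ℤ) :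
    nOdd n (fun j => f j) = ∑ j ∈ Finset.range n, if Odd (f j) then 1 else 0 := by
  rw [nOdd, Nat.card_eq_fintype_card, Fintype.card_subtype, Finset.card_filter,
    Fin.sum_univ_eq_sum_range (fun j => if Odd (f j) then 1 else 0) n]

theorem sum_range_ite_odd_sub (m : ℕ) :
    (∑ j ∈ Finset.range m, if Odd ((m : ℤ) - 1 - j) then 1 else 0) = m / 2 := by
  induction m with
  | zero => simp
  | succ m ih =>
    rw [Finset.sum_range_succ']
    have h : ∀ j : ℕ, ((m + 1 : ℕ) : ℤ) - 1 - ((j + 1 : ℕ) : ℤ) = (m : ℤ) - 1 - j := by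
      intro j; push_cast; ring
    simp only [h, ih]
    push_cast
    simp only [add_sub_cancel_right, sub_zero, Int.odd_iff]
    split_ifs <;> omega

/-- The number of odd entries of `∂′ᵢ`, in closed form. -/
theorem nOdd_dprime (n : ℕ) (i : Fin (n + 1)) :
    nOdd n (dprime n i) = (if Even (n - (i : ℕ)) then (i : ℕ) else 0) + (n - i) / 2 := by
  obtain ⟨i, hi⟩ := i
  obtain ⟨m, rfl⟩ := Nat.exists_eq_add_of_le (Nat.lt_succ_iff.mp hi)
  unfold dprime
  rw [nOdd_eq_sum_range (i + m) (fun j => (if j < i then (i : ℤ) - (j : ℕ) else 0) +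
    (((i + m : ℕ) : ℤ) - 1 - (j : ℕ))), Finset.sum_range_add, Nat.add_sub_cancel_left]
  congr 1
  · have h : ∀ j ∈ Finset.range i, (if Odd ((if j < i then (i : ℤ) - (j : ℕ) else 0) +
        (((i + m : ℕ) : ℤ) - 1 - (j : ℕ))) then 1 else 0) = if Even m then 1 else 0 := by
      intro j hj
      rw [if_pos (Finset.mem_range.mp hj)]
      refine if_congr ?_ rfl rfl
      rw [Int.odd_iff, Nat.even_iff]
      omega
    rw [Finset.sum_congr rfl h]
    simp
  · rw [← sum_range_ite_odd_sub m]
    refine Finset.sum_congr rfl fun j _ => if_congr ?_ rfl rfl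
    rw [if_neg (by omega), Int.odd_iff, Int.odd_iff]
    omega

/-- The map `i ↦ N_odd(∂′ᵢ)` is a bijection from `{0, 1, …, n}` to `{0, 1, …, n}`. -/
theorem nOdd_dprime_bijective (n : ℕ) (hn : 1 ≤ n) :
    Set.BijOn (fun i : Fin (n + 1) => nOdd n (dprime n i)) Set.univ (Set.Iic n) := by
  refine ⟨fun i _ => ?_, fun i _ j _ hij => ?_, fun k hk => ?_⟩
  · have := i.isLt
    simp only [nOdd_dprime, Set.mem_Iic]
    split_ifs <;> omega
  · have := i.isLt
    have := j.isLt
    simp only [nOdd_dprime, Nat.even_iff] at hij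
    ext
    split_ifs at hij <;> omega
  · simp only [Set.mem_Iic] at hk
    simp only [Set.image_univ, Set.mem_range, nOdd_dprime, Nat.even_iff]
    by_cases h : n ≤ 2 * k
    · refine ⟨⟨2 * k - n, by omega⟩, ?_⟩
      dsimp only
      split_ifs <;> omega
    · refine ⟨⟨n - (2 * k + 1), by omega⟩, ?_⟩
      dsimp only
      split_ifs <;> omega
end

section
/- Let n = n₁ + ⋯ + n_k be a composition of n, partition {1, …, n} into consecutive blocks B₁, …, B_k with |B_m| = n_m, fix r₁, …, r_k ∈ ℂ with r_p − r_q ∉ ℤ for p ≠ q, and let Λ = {λ ∈ ℂⁿ : λ_j − r_m ∈ ℤ for all j ∈ B_m}. Let ~ be the equivalence relation on Λ generated by λ ~ λ ± 2e_j (1 ≤ j ≤ n) and λ ~ σ·λ for σ ∈ S_{n₁} × ⋯ × S_{n_k} permuting coordinates within blocks. Then ~ has exactly ∏_{m=1}^{k} (n_m + 1) equivalence classes, and a complete set of pairwise inequivalent representatives is given by the weights (∂_{i₁}, …, ∂_{i_k}) for (i₁, …, i_k) ∈ {0,…,n₁} × ⋯ × {0,…,n_k}, where the coordinates of (∂_{i₁},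 …, ∂_{i_k}) in block B_m equal r_m + 1 in the first i_m positions of the block and r_m in the remaining positions. -/
/-- The index set `{1, …, n}` partitioned into consecutive blocks `B₁, …, B_k`
with `|B_m| = nv m`, encoded as the disjoint union of the blocks. -/
abbrev BIdx (k : ℕ) (nv : Fin k → ℕ) := Σ p : Fin k, Fin (nv p)

/-- One generating step of the equivalence relation: shift a single coordinate by `±2`,
or act by an element of `S_{n₁} × ⋯ × S_{n_k}` permuting coordinates within each block. -/
def bstep (k : ℕ) (nv : Fin k → ℕ) (l m : BIdx k nv → ℂ) : Prop :=
  (∃ j : BIdx k nv, m = l + Pi.single j 2 ∨ m = l - Pi.single j 2) ∨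
  (∃ σ : ∀ p : Fin k, Equiv.Perm (Fin (nv p)), m = fun j => l ⟨j.1, σ j.1 j.2⟩)

/-- `c_m(λ)`: the number of indices `j` in block `B_m` such that `λ_j − r_m` is an odd
integer. -/
noncomputable def oddCount (k : ℕ) (nv : Fin k → ℕ) (r : Fin k → ℂ) (l : BIdx k nv → ℂ) (p : Fin k) : ℕ :=
  Nat.card {j : Fin (nv p) // ∃ z : ℤ, Odd z ∧ l ⟨p, j⟩ - r p = (z : ℂ)}

/-- The set `Λ` of weights with `λ_j − r_m ∈ ℤ` for all `j ∈ B_m`. -/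
def Lam (k : ℕ) (nv : Fin k → ℕ) (r : Fin k → ℂ) :=
  {l : BIdx k nv → ℂ // ∀ j : BIdx k nv, ∃ z : ℤ, l j - r j.1 = (z : ℂ)}

/-- The generating relation restricted to `Λ`. -/
def bstepSub (k : ℕ) (nv : Fin k → ℕ) (r : Fin k → ℂ) (a b : Lam k nv r) : Prop :=
  bstep k nv a.1 b.1

/-- The representative weight `(∂_{i₁}, …, ∂_{i_k})`: in block `B_m` its coordinates are
`r_m + 1` in the first `i_m` positions and `r_m` in the remaining positions. -/
def brep (k : ℕ) (nv : Fin k → ℕ) (r : Fin k → ℂ) (i : ∀ p : Fin k, Fin (nv p + 1)) :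
    BIdx k nv → ℂ :=
  fun j => if (j.2 : ℕ) < (i j.1 : ℕ) then r j.1 + 1 else r j.1

/-- Adding an even integer does not change whether a complex number is an odd integer. -/
lemma exists_odd_sub_iff_of_eq_add_two_mul {x y : ℂ} (c : ℂ) (w : ℤ) (h : y = x + 2 * w) :
    (∃ z : ℤ, Odd z ∧ y - c = z) ↔ ∃ z : ℤ, Odd z ∧ x - c = z := by
  constructor
  · rintro ⟨z, hz, e⟩
    refine ⟨z - 2 * w, hz.sub_even (even_two_mul w), ?_⟩
    push_cast
    linear_combination e - h
  · rintro ⟨z, hz, e⟩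
    refine ⟨z + 2 * w, hz.add_even (even_two_mul w), ?_⟩
    push_cast
    linear_combination e + h

section Blocks

variable {k : ℕ} {nv : Fin k → ℕ}

lemma exists_int_of_add_or_sub_single {l m : BIdx k nv → ℂ} {j : BIdx k nv}
    (h : m = l + Pi.single j 2 ∨ m = l - Pi.single j 2) (i : BIdx k nv) :
    ∃ w : ℤ, m i = l i + 2 * w := by
  rcases h with rfl | rfl <;> rcases eq_or_ne i j with rfl | hij
  · exact ⟨1, by simp⟩
  · exact ⟨0, by simp [hij]⟩
  · exact ⟨-1, by simp [sub_eq_add_neg]⟩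
  · exact ⟨0, by simp [hij]⟩

lemma oddCount_eq_of_bstep (r : Fin k → ℂ) {l m : BIdx k nv → ℂ} (h : bstep k nv l m) :
    oddCount k nv r l = oddCount k nv r m := by
  funext p
  rcases h with ⟨j, h⟩ | ⟨σ, rfl⟩
  · refine Nat.card_congr (Equiv.subtypeEquivRight fun i => ?_)
    obtain ⟨w, hw⟩ := exists_int_of_add_or_sub_single h ⟨p, i⟩
    exact (exists_odd_sub_iff_of_eq_add_two_mul (r p) w hw).symm
  · exact Nat.card_congr ((σ p).subtypeEquiv fun i => Iff.rfl).symm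

lemma oddCount_eq_of_eqvGen (r : Fin k → ℂ) {l m : BIdx k nv → ℂ}
    (h : Relation.EqvGen (bstep k nv) l m) : oddCount k nv r l = oddCount k nv r m := by
  induction h with
  | rel _ _ h => exact oddCount_eq_of_bstep r h
  | refl => rfl
  | symm _ _ _ ih => exact ih.symm
  | trans _ _ _ _ _ ih₁ ih₂ => exact ih₁.trans ih₂

lemma oddCount_lt (r : Fin k → ℂ) (l : BIdx k nv → ℂ) (p : Fin k) :
    oddCount k nv r l p < nv p + 1 := by
  have h := Finite.card_subtype_le
    fun j : Fin (nv p) => ∃ z : ℤ, Odd z ∧ l ⟨p, j⟩ - r p = (z : ℂ)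
  rw [Nat.card_fin] at h
  exact Nat.lt_succ_of_le h

lemma card_fin_subtype_val_lt {n : ℕ} (i : Fin (n + 1)) :
    Nat.card {j : Fin n // (j : ℕ) < i} = i := by
  rw [Nat.card_eq_fintype_card, Fintype.card_subtype, Fin.card_filter_val_lt]
  omega

lemma oddCount_brep (r : Fin k → ℂ) (i : ∀ p : Fin k, Fin (nv p + 1)) (p : Fin k) :
    oddCount k nv r (brep k nv r i) p = i p := by
  rw [← card_fin_subtype_val_lt (i p)]
  refine Nat.card_congr (Equiv.subtypeEquivRight fun j => ?_)
  by_cases h : (j : ℕ) < i p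
  · simp only [brep, h, if_true, iff_true]
    exact ⟨1, odd_one, by simp⟩
  · simp only [brep, h, if_false, iff_false, sub_self]
    rintro ⟨z, hz, e⟩
    have : z = 0 := by exact_mod_cast e.symm
    simp [this] at hz

lemma brep_mem (r : Fin k → ℂ) (i : ∀ p : Fin k, Fin (nv p + 1)) (j : BIdx k nv) :
    ∃ z : ℤ, brep k nv r i j - r j.1 = (z : ℂ) := by
  by_cases h : (j.2 : ℕ) < i j.1
  · exact ⟨1, by simp [brep, h]⟩
  · exact ⟨0, by simp [brep, h]⟩

/-- The translations that preserve every equivalence class. -/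
def classTranslations (k : ℕ) (nv : Fin k → ℕ) : AddSubgroup (BIdx k nv → ℂ) where
  carrier := {v | ∀ l, Relation.EqvGen (bstep k nv) l (l + v)}
  zero_mem' l := by simpa using Relation.EqvGen.refl l
  add_mem' {a b} ha hb l := by
    simpa [add_assoc] using (ha l).trans _ _ _ (hb (l + a))
  neg_mem' {a} ha l := by
    simpa using (ha (l + -a)).symm

lemma eqvGen_of_forall_eq_add_two_mul {l m : BIdx k nv → ℂ}
    (h : ∀ j, ∃ w : ℤ, m j = l j + 2 * w) : Relation.EqvGen (bstep k nv) l m := by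
  choose w hw using h
  have hmem : ∑ j, w j • Pi.single j (2 : ℂ) ∈ classTranslations k nv :=
    sum_mem fun j _ => zsmul_mem (fun l => .rel _ _ (.inl ⟨j, .inl rfl⟩)) _
  have hm : m = l + ∑ j, w j • Pi.single j (2 : ℂ) := by
    funext i
    simp [hw, Finset.sum_apply, Pi.single_apply, mul_comm]
  rw [hm]
  exact hmem l

lemma exists_perm_iff_of_card_eq {α : Type*} [Finite α] {P Q : α → Prop}
    (h : Nat.card {a // P a} = Nat.card {a // Q a}) :
    ∃ σ : Equiv.Perm α, ∀ a, Q (σ a) ↔ P a := by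
  classical
  have := Fintype.ofFinite α
  rw [Nat.card_eq_fintype_card, Nat.card_eq_fintype_card] at h
  let e := Fintype.equivOfCardEq h
  refine ⟨e.extendSubtype, fun a => ⟨fun hq => ?_, e.extendSubtype_mem a⟩⟩
  by_contra hp
  exact e.extendSubtype_not_mem a hp hq

lemma eqvGen_brep (r : Fin k → ℂ) {l : BIdx k nv → ℂ}
    (hl : ∀ j : BIdx k nv, ∃ z : ℤ, l j - r j.1 = (z : ℂ)) {i : ∀ p : Fin k, Fin (nv p + 1)}
    (hi : ∀ p, (i p : ℕ) = oddCount k nv r l p) :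
    Relation.EqvGen (bstep k nv) l (brep k nv r i) := by
  have hσ (p : Fin k) := exists_perm_iff_of_card_eq ((card_fin_subtype_val_lt (i p)).trans (hi p))
  choose σ hσ using hσ
  refine .trans _ _ _ (.rel _ _ (.inr ⟨σ, rfl⟩)) (eqvGen_of_forall_eq_add_two_mul ?_)
  rintro ⟨p, j⟩
  by_cases h : (j : ℕ) < i p
  · obtain ⟨_, ⟨w, rfl⟩, e⟩ := (hσ p j).2 h
    refine ⟨-w, ?_⟩
    simp only [brep, h, if_true]
    push_cast at e ⊢
    linear_combination -e
  · obtain ⟨z, e⟩ := hl ⟨p, σ p j⟩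
    have hz : Even z := Int.not_odd_iff_even.1 fun hz => h ((hσ p j).1 ⟨z, hz, e⟩)
    obtain ⟨w, rfl⟩ := hz
    refine ⟨-w, ?_⟩
    simp only [brep, h, if_false]
    push_cast at e ⊢
    linear_combination -e

lemma mem_iff_of_bstep (r : Fin k → ℂ) {l m : BIdx k nv → ℂ} (h : bstep k nv l m) :
    (∀ j : BIdx k nv, ∃ z : ℤ, l j - r j.1 = (z : ℂ)) ↔
      ∀ j : BIdx k nv, ∃ z : ℤ, m j - r j.1 = (z : ℂ) := by
  rcases h with ⟨j, h⟩ | ⟨σ, rfl⟩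
  · refine forall_congr' fun i => ?_
    obtain ⟨w, hw⟩ := exists_int_of_add_or_sub_single h i
    constructor
    · rintro ⟨z, e⟩
      refine ⟨z + 2 * w, ?_⟩
      push_cast
      linear_combination e + hw
    · rintro ⟨z, e⟩
      refine ⟨z - 2 * w, ?_⟩
      push_cast
      linear_combination e - hw
  · refine ⟨fun hl j => hl ⟨j.1, σ j.1 j.2⟩, ?_⟩
    rintro hl ⟨p, j⟩
    simpa using hl ⟨p, (σ p).symm j⟩

lemma mem_iff_and_eqvGen_bstepSub (r : Fin k → ℂ) {l m : BIdx k nv → ℂ}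
    (h : Relation.EqvGen (bstep k nv) l m) :
    ((∀ j : BIdx k nv, ∃ z : ℤ, l j - r j.1 = (z : ℂ)) ↔
      ∀ j : BIdx k nv, ∃ z : ℤ, m j - r j.1 = (z : ℂ)) ∧
    ∀ hl hm, Relation.EqvGen (bstepSub k nv r) ⟨l, hl⟩ ⟨m, hm⟩ := by
  induction h with
  | rel _ _ h => exact ⟨mem_iff_of_bstep r h, fun _ _ => .rel _ _ h⟩
  | refl => exact ⟨Iff.rfl, fun _ _ => .refl _⟩
  | symm _ _ _ ih => exact ⟨ih.1.symm, fun hl hm => (ih.2 hm hl).symm⟩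
  | trans _ _ _ _ _ ih₁ ih₂ =>
    exact ⟨ih₁.1.trans ih₂.1, fun hl hm =>
      (ih₁.2 hl (ih₁.1.1 hl)).trans _ _ _ (ih₂.2 (ih₁.1.1 hl) hm)⟩

/-- The tuple of odd counts as a function on equivalence classes. -/
noncomputable def quotOddCount (k : ℕ) (nv : Fin k → ℕ) (r : Fin k → ℂ) :
    Quot (bstepSub k nv r) → ∀ p : Fin k, Fin (nv p + 1) :=
  Quot.lift (fun a p => ⟨oddCount k nv r a.1 p, oddCount_lt r a.1 p⟩) fun _ _ h =>
    funext fun p => Fin.ext (congrFun (oddCount_eq_of_bstep r h) p)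

lemma quotOddCount_bijective (r : Fin k → ℂ) : Function.Bijective (quotOddCount k nv r) := by
  constructor
  · rintro ⟨a⟩ ⟨b⟩ h
    have hab : ∀ p, oddCount k nv r a.1 p = oddCount k nv r b.1 p := fun p =>
      congrArg Fin.val (congrFun h p)
    have ha := eqvGen_brep r a.2 (i := fun p => ⟨_, oddCount_lt r a.1 p⟩) fun _ => rfl
    have hb := eqvGen_brep r b.2 (i := fun p => ⟨_, oddCount_lt r a.1 p⟩) hab
    exact Quot.eqvGen_sound ((mem_iff_and_eqvGen_bstepSub r
      (ha.trans _ _ _ hb.symm)).2 a.2 b.2)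
  · exact fun i => ⟨Quot.mk _ ⟨brep k nv r i, brep_mem r i⟩,
      funext fun p => Fin.ext (oddCount_brep r i p)⟩

end Blocks

/-- The equivalence relation on `Λ` generated by `λ ~ λ ± 2eⱼ` and within-block
permutations has exactly `∏_m (n_m + 1)` classes, and the weights `(∂_{i₁}, …, ∂_{i_k})`
form a complete set of pairwise inequivalent representatives: `λ ~ (∂_{i₁}, …, ∂_{i_k})`
iff `i_m = c_m(λ)` for all `m`. -/
theorem parabolic_blocks_card_and_representatives (k : ℕ) (nv : Fin k → ℕ)
    (hnv : ∀ p, 1 ≤ nv p) (r : Fin k → ℂ)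
    (hr : ∀ p q : Fin k, p ≠ q → ∀ z : ℤ, r p - r q ≠ (z : ℂ)) :
    Nat.card (Quot (bstepSub k nv r)) = ∏ p : Fin k, (nv p + 1) ∧
    ∀ l : BIdx k nv → ℂ, (∀ j : BIdx k nv, ∃ z : ℤ, l j - r j.1 = (z : ℂ)) →
      ∀ i : ∀ p : Fin k, Fin (nv p + 1),
        (Relation.EqvGen (bstep k nv) l (brep k nv r i) ↔
          ∀ p : Fin k, (i p : ℕ) = oddCount k nv r l p) := by
  refine ⟨?_, fun l hl i => ⟨fun h p => ?_, eqvGen_brep r hl⟩⟩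
  · rw [Nat.card_eq_of_bijective _ (quotOddCount_bijective r), Nat.card_pi]
    simp
  · rw [oddCount_eq_of_eqvGen r h, oddCount_brep]
end

section
/- Equip ℂⁿ with the bilinear form ⟨·,·⟩ determined by ⟨eᵢ, eⱼ⟩ = δᵢⱼ, and let Φ₀⁺ = {eᵢ − eⱼ : 1 ≤ i < j ≤ n}. Fix a composition n = n₁ + ⋯ + n_k, partition {1, …, n} into consecutive blocks of sizes n₁, …, n_k, let Φ⁺(𝔩) ⊆ Φ₀⁺ consist of those eᵢ − eⱼ with i and j in the same block, and let w₀^𝔭 ∈ Sₙ be the permutation that reverses the order of the indices within each block (acting on ℂⁿ by permuting coordinates). Suppose λ ∈ ℂⁿ satisfies ⟨λ, α⟩ ∈ ℤ_{>0} for all α ∈ Φ⁺(𝔩). Then ∏_{β ∈ Φ⁺(𝔩)} (⟨λ, β⟩ − 1) · ∏_{γ ∈ Φ₀⁺ ∖ Φ⁺(𝔩)} (⟨λ, γ⟩ + 1) ≠ 0 if and only if ⟨−w₀^𝔭 λ, β⟩ ≠ 1 for every β ∈ Φ₀⁺. -/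
/-- The (0-based) position of an index in `{1, …, n}` when the blocks are placed
consecutively; it realizes the lexicographic order on block indices. -/
def bpos (k : ℕ) (nv : Fin k → ℕ) (j : BIdx k nv) : ℕ :=
  (∑ p : Fin k, if p < j.1 then nv p else 0) + (j.2 : ℕ)

/-- The bilinear form on `ℂⁿ` with `⟨eᵢ, eⱼ⟩ = δᵢⱼ`. -/
noncomputable def binn (k : ℕ) (nv : Fin k → ℕ) (x y : BIdx k nv → ℂ) : ℂ := ∑ j, x j * y j

/-- The standard basis vector `eᵢ`. -/
def bee (k : ℕ) (nv : Fin k → ℕ) (i : BIdx k nv) : BIdx k nv → ℂ := Pi.single i 1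

/-- The longest element `w₀^𝔭` of `S_{n₁} × ⋯ × S_{n_k}`: the permutation reversing the
order of the indices within each block. -/
def bw0 (k : ℕ) (nv : Fin k → ℕ) : Equiv.Perm (BIdx k nv) :=
  Equiv.sigmaCongrRight fun _ => Fin.revPerm

/-- The action of `w₀^𝔭` on `ℂⁿ` by permuting coordinates, determined by
`w · eᵢ = e_{w(i)}`. -/
def bw0act (k : ℕ) (nv : Fin k → ℕ) (v : BIdx k nv → ℂ) : BIdx k nv → ℂ :=
  fun j => v ((bw0 k nv).symm j)

theorem binn_sub_bee (k : ℕ) (nv : Fin k → ℕ) (x : BIdx k nv → ℂ) (i j : BIdx k nv) :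
    binn k nv x (bee k nv i - bee k nv j) = x i - x j := by
  simp [binn, bee, mul_sub, Finset.sum_sub_distrib, Pi.single_apply]

theorem bpos_lt_of_fst_lt (k : ℕ) (nv : Fin k → ℕ) {i j : BIdx k nv} (h : i.1 < j.1) :
    bpos k nv i < bpos k nv j := by
  have hsum : (∑ p : Fin k, if p < i.1 then nv p else 0) + nv i.1 ≤
      ∑ p : Fin k, if p < j.1 then nv p else 0 := by
    calc
      _ = ∑ p : Fin k, ((if p < i.1 then nv p else 0) + if p = i.1 then nv p else 0) := by
        simp [Finset.sum_add_distrib]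
      _ ≤ _ := by
        refine Finset.sum_le_sum fun p _ => ?_
        split_ifs <;> omega
  have hi := i.2.isLt
  unfold bpos
  omega

theorem bpos_lt_iff_of_fst_ne (k : ℕ) (nv : Fin k → ℕ) {i j : BIdx k nv} (h : i.1 ≠ j.1) :
    bpos k nv i < bpos k nv j ↔ i.1 < j.1 := by
  refine ⟨fun hlt => ?_, bpos_lt_of_fst_lt k nv⟩
  by_contra hn
  exact lt_asymm hlt (bpos_lt_of_fst_lt k nv (lt_of_le_of_ne (not_lt.mp hn) h.symm))

theorem bw0_fst (k : ℕ) (nv : Fin k → ℕ) (i : BIdx k nv) : (bw0 k nv i).1 = i.1 := rfl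

theorem bw0_symm (k : ℕ) (nv : Fin k → ℕ) : (bw0 k nv).symm = bw0 k nv := rfl

theorem bw0_bw0 (k : ℕ) (nv : Fin k → ℕ) (i : BIdx k nv) : bw0 k nv (bw0 k nv i) = i :=
  (bw0 k nv).symm_apply_apply i

theorem bpos_bw0_lt_iff_of_fst_eq (k : ℕ) (nv : Fin k → ℕ) {i j : BIdx k nv}
    (h : i.1 = j.1) :
    bpos k nv (bw0 k nv i) < bpos k nv (bw0 k nv j) ↔ bpos k nv j < bpos k nv i := by
  obtain ⟨p, a⟩ := i
  obtain ⟨q, b⟩ := j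
  obtain rfl : p = q := h
  have hrev (c : Fin (nv p)) : bw0 k nv ⟨p, c⟩ = ⟨p, c.rev⟩ := rfl
  rw [hrev, hrev]
  simp only [bpos, add_lt_add_iff_left, Fin.val_fin_lt, Fin.rev_lt_rev]

theorem bpos_bw0_lt_iff_of_fst_ne (k : ℕ) (nv : Fin k → ℕ) {i j : BIdx k nv}
    (h : i.1 ≠ j.1) :
    bpos k nv (bw0 k nv i) < bpos k nv (bw0 k nv j) ↔ bpos k nv i < bpos k nv j := by
  rw [bpos_lt_iff_of_fst_ne k nv h, bpos_lt_iff_of_fst_ne k nv (by simpa only [bw0_fst] using h),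
    bw0_fst, bw0_fst]

theorem binn_neg_bw0act_sub_bee (k : ℕ) (nv : Fin k → ℕ) (l : BIdx k nv → ℂ)
    (i j : BIdx k nv) :
    binn k nv (-(bw0act k nv l)) (bee k nv i - bee k nv j) =
      l (bw0 k nv j) - l (bw0 k nv i) := by
  rw [binn_sub_bee]
  simp only [Pi.neg_apply, bw0act, bw0_symm]
  ring


/-- Let `Φ₀⁺ = {eᵢ − eⱼ : i < j}` and `Φ⁺(𝔩) ⊆ Φ₀⁺` the roots with `i, j` in the same
block. If `⟨λ, α⟩ ∈ ℤ_{>0}` for all `α ∈ Φ⁺(𝔩)`, then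
`∏_{β ∈ Φ⁺(𝔩)} (⟨λ, β⟩ − 1) · ∏_{γ ∈ Φ₀⁺ ∖ Φ⁺(𝔩)} (⟨λ, γ⟩ + 1) ≠ 0` iff
`⟨−w₀^𝔭 λ, β⟩ ≠ 1` for every `β ∈ Φ₀⁺`. -/
theorem weakly_typical_iff (k : ℕ) (nv : Fin k → ℕ) (hnv : ∀ p, 1 ≤ nv p)
    (l : BIdx k nv → ℂ)
    (hdom : ∀ i j : BIdx k nv, bpos k nv i < bpos k nv j → i.1 = j.1 →
      ∃ z : ℤ, 0 < z ∧ binn k nv l (bee k nv i - bee k nv j) = (z : ℂ)) :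
    ((∏ q ∈ Finset.univ.filter
        (fun q : BIdx k nv × BIdx k nv => bpos k nv q.1 < bpos k nv q.2 ∧ q.1.1 = q.2.1),
        (binn k nv l (bee k nv q.1 - bee k nv q.2) - 1)) *
     (∏ q ∈ Finset.univ.filter
        (fun q : BIdx k nv × BIdx k nv => bpos k nv q.1 < bpos k nv q.2 ∧ q.1.1 ≠ q.2.1),
        (binn k nv l (bee k nv q.1 - bee k nv q.2) + 1)) ≠ 0) ↔
    ∀ i j : BIdx k nv, bpos k nv i < bpos k nv j →
      binn k nv (-(bw0act k nv l)) (bee k nv i - bee k nv j) ≠ 1 := by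
  rw [mul_ne_zero_iff, Finset.prod_ne_zero_iff, Finset.prod_ne_zero_iff]
  simp only [Finset.mem_filter, Finset.mem_univ, true_and, Prod.forall,
    binn_neg_bw0act_sub_bee]
  simp only [binn_sub_bee]
  constructor
  · rintro ⟨hsame, hdiff⟩ i j hij heq
    by_cases h : i.1 = j.1
    · exact hsame (bw0 k nv j) (bw0 k nv i)
        ⟨(bpos_bw0_lt_iff_of_fst_eq k nv h.symm).2 hij, h.symm⟩ (by linear_combination heq)
    · exact hdiff (bw0 k nv i) (bw0 k nv j)
        ⟨(bpos_bw0_lt_iff_of_fst_ne k nv h).2 hij, h⟩ (by linear_combination -heq)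
  · refine fun hw => ⟨fun i j ⟨hij, h⟩ heq => ?_, fun i j ⟨hij, h⟩ heq => ?_⟩
    · refine hw (bw0 k nv j) (bw0 k nv i) ((bpos_bw0_lt_iff_of_fst_eq k nv h.symm).2 hij) ?_
      rw [bw0_bw0, bw0_bw0]
      linear_combination heq
    · refine hw (bw0 k nv i) (bw0 k nv j) ((bpos_bw0_lt_iff_of_fst_ne k nv h).2 hij) ?_
      rw [bw0_bw0, bw0_bw0]
      linear_combination -heq
end

section
/- Let n ≥ 1 and let F be the free abelian group on the set ℂⁿ (formal ℤ-linear combinations of symbols [μ], μ ∈ ℂⁿ). Let S = {κ ∈ ℂⁿ : κᵢ ∈ {0, 2} for all i}. For a ∈ ℂ define two relations on ℂⁿ: write ν ⇢ₐ μ if there is an index i with νᵢ = a, μᵢ = νᵢ + 1 or μᵢ = νᵢ − 1, and μⱼ = νⱼ for all j ≠ i; write ν ⇝ₐ μ if there is an index i with either (νᵢ = a and μᵢ = νᵢ + 1) or (νᵢ = a + 2 and μᵢ = νᵢ − 1), and μⱼ = νⱼ for all j ≠ i. Then for every λ ∈ ℂⁿ and every a ∈ ℂ the following identity holds in F: Σ_{κ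 ∈ S} Σ_{μ : (λ−κ) ⇢ₐ μ} [μ] = Σ_{μ : λ ⇝ₐ μ} Σ_{κ ∈ S} [μ − κ]. -/
/-- `ν ⇢ₐ μ`: there is an index `i` with `νᵢ = a`, `μᵢ = νᵢ + 1` or `μᵢ = νᵢ − 1`, and
`μⱼ = νⱼ` for `j ≠ i`. -/
def relA (n : ℕ) (a : ℂ) (ν μ : Fin n → ℂ) : Prop :=
  ∃ i : Fin n, ν i = a ∧
    (μ = Function.update ν i (ν i + 1) ∨ μ = Function.update ν i (ν i - 1))

/-- `ν ⇝ₐ μ`: there is an index `i` with either (`νᵢ = a` and `μᵢ = νᵢ + 1`) or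
(`νᵢ = a + 2` and `μᵢ = νᵢ − 1`), and `μⱼ = νⱼ` for `j ≠ i`. -/
def relB (n : ℕ) (a : ℂ) (ν μ : Fin n → ℂ) : Prop :=
  ∃ i : Fin n,
    (ν i = a ∧ μ = Function.update ν i (ν i + 1)) ∨
    (ν i = a + 2 ∧ μ = Function.update ν i (ν i - 1))

/-- A sum over the points obtained from `ν` by shifting one coordinate `i` by a nonzero element
of `A i` is the sum over all pairs of a coordinate and a shift. -/
theorem finsum_mem_update_add {ι R M : Type*} [Fintype ι] [DecidableEq ι] [AddGroup R]
    [AddCommMonoid M] (ν : ι → R) (A : ι → Finset R) (hA : ∀ i, 0 ∉ A i)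
    (g : (ι → R) → M) :
    ∑ᶠ μ ∈ {μ : ι → R | ∃ i, ∃ e ∈ A i, μ = Function.update ν i (ν i + e)}, g μ =
      ∑ i, ∑ e ∈ A i, g (Function.update ν i (ν i + e)) := by
  classical
  let f : (Σ _ : ι, R) → ι → R := fun p => Function.update ν p.1 (ν p.1 + p.2)
  have hset : {μ : ι → R | ∃ i, ∃ e ∈ A i, μ = Function.update ν i (ν i + e)} =
      ((Finset.univ.sigma A).image f : Finset (ι → R)) := by
    ext μ
    simp [f, eq_comm]
  rw [hset, finsum_mem_coe_finset, Finset.sum_image, Finset.sum_sigma]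
  rintro ⟨i, e⟩ hi ⟨j, d⟩ hj hij
  have he : e ≠ 0 := fun h => hA i (by simpa [h] using hi)
  have h := congrFun hij i
  by_cases h' : i = j
  · subst h'
    simpa [f] using h
  · simp [f, Function.update_of_ne h', he] at h

/-- Summing over a product of finite sets can be done by summing first over one coordinate, the
others being read off from the points whose coordinate there is a fixed element `e`. -/
theorem Fintype.sum_piFinset_eq_sum_ite_update {ι R M : Type*} [Fintype ι] [DecidableEq ι]
    [DecidableEq R] [AddCommMonoid M] (B : ι → Finset R) (i : ι) {e : R} (he : e ∈ B i)
    (h : (ι → R) → M) :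
    ∑ κ ∈ Fintype.piFinset B, h κ = ∑ κ ∈ Fintype.piFinset B,
      if κ i = e then ∑ b ∈ B i, h (Function.update κ i b) else 0 := by
  have hupd : ∀ κ ∈ Fintype.piFinset B, ∀ b ∈ B i,
      Function.update κ i b ∈ Fintype.piFinset B := by
    intro κ hκ b hb
    rw [Fintype.mem_piFinset] at hκ ⊢
    intro j
    by_cases hj : j = i
    · subst hj
      simpa using hb
    · simpa [hj] using hκ j
  rw [← Finset.sum_filter, Finset.sum_comm, ← Finset.sum_fiberwise_of_maps_to
    (g := fun κ : ι → R => κ i) (fun κ hκ => Fintype.mem_piFinset.1 hκ i)]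
  refine Finset.sum_congr rfl fun b hb => ?_
  refine Finset.sum_nbij' (fun κ => Function.update κ i e) (fun κ => Function.update κ i b)
    ?_ ?_ ?_ ?_ ?_
  · intro κ hκ
    rw [Finset.mem_filter] at hκ ⊢
    exact ⟨hupd κ hκ.1 e he, by simp⟩
  · intro κ hκ
    rw [Finset.mem_filter] at hκ ⊢
    exact ⟨hupd κ hκ.1 b hb, by simp⟩
  all_goals
    intro κ hκ
    simp [← (Finset.mem_filter.1 hκ).2]

theorem finsum_mem_relA {M : Type*} [AddCommMonoid M] (n : ℕ) (a : ℂ) (ν : Fin n → ℂ)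
    (g : (Fin n → ℂ) → M) :
    ∑ᶠ μ ∈ {μ : Fin n → ℂ | relA n a ν μ}, g μ =
      ∑ i, if ν i = a then
        g (Function.update ν i (a + 1)) + g (Function.update ν i (a - 1)) else 0 := by
  have hset : {μ : Fin n → ℂ | relA n a ν μ} = {μ | ∃ i,
      ∃ e ∈ (if ν i = a then {1, -1} else ∅ : Finset ℂ),
        μ = Function.update ν i (ν i + e)} := by
    ext μ
    refine exists_congr fun i => ?_
    split_ifs with h <;> simp [h, sub_eq_add_neg]
  rw [hset, finsum_mem_update_add _ _ (fun i => by split_ifs <;> simp)]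
  refine Finset.sum_congr rfl fun i _ => ?_
  split_ifs with h
  · rw [Finset.sum_pair (by norm_num), h, sub_eq_add_neg]
  · simp

theorem finsum_mem_relB {M : Type*} [AddCommMonoid M] (n : ℕ) (a : ℂ) (ν : Fin n → ℂ)
    (g : (Fin n → ℂ) → M) :
    ∑ᶠ μ ∈ {μ : Fin n → ℂ | relB n a ν μ}, g μ =
      ∑ i, if ν i = a ∨ ν i = a + 2 then g (Function.update ν i (a + 1)) else 0 := by
  have hset : {μ : Fin n → ℂ | relB n a ν μ} = {μ | ∃ i,
      ∃ e ∈ (if ν i = a then {1} else if ν i = a + 2 then {-1} else ∅ : Finset ℂ),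
        μ = Function.update ν i (ν i + e)} := by
    ext μ
    refine exists_congr fun i => ?_
    split_ifs with h h' <;> simp [*, sub_eq_add_neg]
  rw [hset, finsum_mem_update_add _ _ (fun i => by split_ifs <;> simp)]
  refine Finset.sum_congr rfl fun i _ => ?_
  by_cases h : ν i = a
  · simp [h]
  · by_cases h' : ν i = a + 2
    · have : a + 2 + -1 = a + 1 := by ring
      simp [h', this]
    · simp [h, h']

/-- The formal identity in the free abelian group on `ℂⁿ` proving Lemma 4.11:
`Σ_{κ ∈ S} Σ_{μ : (λ−κ) ⇢ₐ μ} [μ] = Σ_{μ : λ ⇝ₐ μ} Σ_{κ ∈ S} [μ − κ]`,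
where `S = {κ : κᵢ ∈ {0, 2} for all i}`. -/
theorem translation_dual_verma_character_identity (n : ℕ) (hn : 1 ≤ n) (a : ℂ)
    (l : Fin n → ℂ) (S : Finset (Fin n → ℂ))
    (hS : ∀ κ : Fin n → ℂ, κ ∈ S ↔ ∀ i : Fin n, κ i = 0 ∨ κ i = 2) :
    ∑ κ ∈ S, ∑ᶠ μ ∈ {μ : Fin n → ℂ | relA n a (l - κ) μ}, FreeAbelianGroup.of μ =
    ∑ᶠ μ ∈ {μ : Fin n → ℂ | relB n a l μ}, ∑ κ ∈ S, FreeAbelianGroup.of (μ - κ) := by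
  have hS' : S = Fintype.piFinset fun _ : Fin n => ({0, 2} : Finset ℂ) := by
    ext κ
    simp [hS]
  simp_rw [finsum_mem_relA, finsum_mem_relB]
  rw [Finset.sum_comm]
  refine Finset.sum_congr rfl fun i _ => ?_
  have hshift : ∀ (κ : Fin n → ℂ) (b : ℂ), Function.update (l - κ) i (a + 1 - b) =
      Function.update l i (a + 1) - Function.update κ i b := by
    intro κ b
    rw [Function.update_sub]
  have hplus : ∀ κ : Fin n → ℂ, Function.update (l - κ) i (a + 1) =
      Function.update l i (a + 1) - Function.update κ i 0 := by
    intro κ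
    rw [← hshift, sub_zero]
  have hminus : ∀ κ : Fin n → ℂ, Function.update (l - κ) i (a - 1) =
      Function.update l i (a + 1) - Function.update κ i 2 := by
    intro κ
    rw [← hshift]
    congr 1
    ring
  split_ifs with h
  · have he : l i - a ∈ ({0, 2} : Finset ℂ) := by
      rcases h with h | h <;> simp [h]
    rw [hS', Fintype.sum_piFinset_eq_sum_ite_update _ i he
      fun κ => FreeAbelianGroup.of (Function.update l i (a + 1) - κ)]
    refine Finset.sum_congr rfl fun κ _ => ?_
    have hiff : (l - κ) i = a ↔ κ i = l i - a := by
      rw [Pi.sub_apply, sub_eq_iff_eq_add, eq_sub_iff_add_eq, eq_comm, add_comm]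
    simp only [hiff, hplus, hminus]
    rw [Finset.sum_pair (by norm_num)]
  · refine Finset.sum_eq_zero fun κ hκ => if_neg fun hi => h ?_
    rw [Pi.sub_apply, sub_eq_iff_eq_add] at hi
    rcases (hS κ).1 hκ i with h0 | h0 <;> simp [hi, h0]
end
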